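/- arXiv:2202.03100 — 2 statements merged into one kernel-verified Lean document; each statement's English description precedes it below -/
import Mathlib

section
/- Let 𝒲, 𝒳, 𝒴, 𝓑 be finite sets, P_W a distribution on 𝒲, and π_{XY} a distribution on 𝒳×𝒴. For n ≥ 1, let Γ^{(n)}(π_{XY}, P_W) be the infimum of D(P_{Y^n|X^n} ‖ π_{Y|X}^n | π_X^n) over all sequential codes {(P_{B_k|W^k X^k B^{k-1}}, P_{Y_k|W^k B^k Y^{k-1}})}_{k=1}^n of blocklength n. Then Γ^{(n)} is subadditive: Γ^{(m+n)}(π_{XY}, P_W) ≤ Γ^{(m)}(π_{XY}, P_W) + Γ^{(n)}(π_{XY}, P_W) for all m, n ≥ 1. -/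
open scoped BigOperators ENNReal
open Classical

noncomputable section

/-- `p` is a probability mass function on the finite type `α`. -/
def IsDist {α : Type} [Fintype α] (p : α → ℝ) : Prop :=
  (∀ a, 0 ≤ p a) ∧ (∑ a, p a) = 1

/-- `k` is a conditional probability kernel. -/
def IsKernel {α β : Type} [Fintype β] (k : α → β → ℝ) : Prop :=
  ∀ a, (∀ b, 0 ≤ k a b) ∧ (∑ b, k a b) = 1

/-- Marginal (pushforward) of `p` along the map `f`. -/
def marg {α β : Type} [Fintype α] (f : α → β) (p : α → ℝ) : β → ℝ :=
  fun b => ∑ a, if f a = b then p a else 0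

/-- Shannon entropy (natural log). -/
def ent {α : Type} [Fintype α] (p : α → ℝ) : ℝ :=
  ∑ a, Real.negMulLog (p a)

/-- Conditional entropy `H(f(A) | g(A))` for `A ∼ p`. -/
def condEnt {α β γ : Type} [Fintype α] [Fintype β] [Fintype γ]
    (f : α → β) (g : α → γ) (p : α → ℝ) : ℝ :=
  ent (marg (fun a => (f a, g a)) p) - ent (marg g p)

/-- Kullback–Leibler divergence `D(p‖q)` with value `⊤` if `p` is not absolutely
continuous with respect to `q`. -/
def KL {α : Type} [Fintype α] (p q : α → ℝ) : ℝ≥0∞ :=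
  if ∀ a, q a = 0 → p a = 0 then ENNReal.ofReal (∑ a, p a * Real.log (p a / q a)) else ⊤

/-- The joint distribution `π_X P_{UV} P_{B|XUV} P_{Y|BUV}` on `X × U × V × B × Y`. -/
def seqJoint {X Y B U V : Type} (πX : X → ℝ) (PUV : U × V → ℝ)
    (PB : X × U × V → B → ℝ) (PY : B × U × V → Y → ℝ) : X × U × V × B × Y → ℝ :=
  fun q => πX q.1 * PUV (q.2.1, q.2.2.1) * PB (q.1, q.2.1, q.2.2.1) q.2.2.2.1 *
    PY (q.2.2.2.1, q.2.1, q.2.2.1) q.2.2.2.2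

/-- The set of values `D(P_{Y|XV} ‖ π_{Y|X} | π_X P_V)` over all feasible tuples
`(𝒰, 𝒱, P_{UV}, P_{B|XUV}, P_{Y|BUV})` with `H(U|V) ≤ H(BU|XYV) + t`. -/
def psiSet (X Y B : Type) [Fintype X] [Fintype Y] [Fintype B] (π : X × Y → ℝ) (t : ℝ) :
    Set ℝ≥0∞ :=
  { d | ∃ (m l : ℕ) (PUV : Fin m × Fin l → ℝ)
      (PB : X × Fin m × Fin l → B → ℝ) (PY : B × Fin m × Fin l → Y → ℝ),
      IsDist PUV ∧ IsKernel PB ∧ IsKernel PY ∧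
      condEnt (fun q : X × Fin m × Fin l × B × Y => q.2.1)
          (fun q => q.2.2.1) (seqJoint (marg Prod.fst π) PUV PB PY) ≤
        condEnt (fun q : X × Fin m × Fin l × B × Y => (q.2.2.2.1, q.2.1))
          (fun q => (q.1, q.2.2.2.2, q.2.2.1)) (seqJoint (marg Prod.fst π) PUV PB PY) + t ∧
      d = KL (marg (fun q : X × Fin m × Fin l × B × Y => (q.1, q.2.2.1, q.2.2.2.2))
              (seqJoint (marg Prod.fst π) PUV PB PY))
            (fun r : X × Fin l × Y => marg Prod.snd PUV r.2.1 * π (r.1, r.2.2)) }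

/-- `Ψ(t)`, with the convention `Ψ(t) = ⊤` when there is no feasible tuple. -/
def Psi (X Y B : Type) [Fintype X] [Fintype Y] [Fintype B] (π : X × Y → ℝ) (t : ℝ) : ℝ≥0∞ :=
  sInf (psiSet X Y B π t)

/-- A sequential code of blocklength `n`: at epoch `k`, the encoder produces
`B_k` from `(W^k, X^k, B^{k-1})` and the decoder produces `Y_k` from
`(W^k, B^k, Y^{k-1})`.  Kernels are given on full histories together with
causality (prefix-dependence) conditions. -/
structure SeqCode (W X Y B : Type) [Fintype W] [Fintype X] [Fintype Y] [Fintype B]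
    (n : ℕ) where
  enc : Fin n → (Fin n → W) → (Fin n → X) → (Fin n → B) → B → ℝ
  dec : Fin n → (Fin n → W) → (Fin n → B) → (Fin n → Y) → Y → ℝ
  enc_dist : ∀ k w x b, IsDist (enc k w x b)
  dec_dist : ∀ k w b y, IsDist (dec k w b y)
  enc_causal : ∀ k w w' x x' b b',
    (∀ i, i ≤ k → w i = w' i) → (∀ i, i ≤ k → x i = x' i) → (∀ i, i < k → b i = b' i) →
    enc k w x b = enc k w' x' b'
  dec_causal : ∀ k w w' b b' y y',
    (∀ i, i ≤ k → w i = w' i) → (∀ i, i ≤ k → b i = b' i) → (∀ i, i < k → y i = y' i) →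
    dec k w b y = dec k w' b' y'

/-- The channel `P_{Y^n|X^n}` synthesized by a sequential code, with common
randomness `W_i` i.i.d. `∼ P_W`. -/
def SeqCode.channel {W X Y B : Type} [Fintype W] [Fintype X] [Fintype Y] [Fintype B]
    {n : ℕ} (C : SeqCode W X Y B n) (PW : W → ℝ) (x : Fin n → X) (y : Fin n → Y) : ℝ :=
  ∑ w : Fin n → W, ∑ b : Fin n → B,
    (∏ k, PW (w k)) * (∏ k, C.enc k w x b (b k)) * (∏ k, C.dec k w b y (y k))

/-- `Γ^{(n)}(π_{XY}, P_W)`: the least value of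
`D(P_{Y^n|X^n} ‖ π_{Y|X}^n | π_X^n)` over sequential codes of blocklength `n`. -/
def GammaN (W X Y B : Type) [Fintype W] [Fintype X] [Fintype Y] [Fintype B]
    (PW : W → ℝ) (π : X × Y → ℝ) (n : ℕ) : ℝ≥0∞ :=
  sInf { d | ∃ C : SeqCode W X Y B n,
    d = KL
      (fun p : (Fin n → X) × (Fin n → Y) =>
        (∏ i, marg Prod.fst π (p.1 i)) * C.channel PW p.1 p.2)
      (fun p : (Fin n → X) × (Fin n → Y) => ∏ i, π (p.1 i, p.2 i)) }

theorem KL_le_add_of_tensor {α β γ : Type} [Fintype α] [Fintype β] [Fintype γ] (e : α × β ≃ γ)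
    {p q : γ → ℝ} {p₁ q₁ : α → ℝ} {p₂ q₂ : β → ℝ}
    (hp : ∀ a b, p (e (a, b)) = p₁ a * p₂ b) (hq : ∀ a b, q (e (a, b)) = q₁ a * q₂ b)
    (h₁ : ∑ a, p₁ a = 1) (h₂ : ∑ b, p₂ b = 1) :
    KL p q ≤ KL p₁ q₁ + KL p₂ q₂ := by
  by_cases ac₁ : ∀ a, q₁ a = 0 → p₁ a = 0
  swap
  · simp [KL, if_neg ac₁]
  by_cases ac₂ : ∀ b, q₂ b = 0 → p₂ b = 0
  swap
  · simp [KL, if_neg ac₂]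
  have ac : ∀ c, q c = 0 → p c = 0 := by
    intro c
    obtain ⟨⟨a, b⟩, rfl⟩ := e.surjective c
    rw [hp, hq, mul_eq_zero, mul_eq_zero]
    exact Or.imp (ac₁ a) (ac₂ b)
  simp only [KL, if_pos ac₁, if_pos ac₂, if_pos ac]
  refine le_of_eq_of_le (congrArg _ ?_) ENNReal.ofReal_add_le
  have hterm : ∀ a b, p (e (a, b)) * Real.log (p (e (a, b)) / q (e (a, b))) =
      (p₁ a * Real.log (p₁ a / q₁ a)) * p₂ b + p₁ a * (p₂ b * Real.log (p₂ b / q₂ b)) := by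
    intro a b
    rw [hp, hq]
    by_cases ha : p₁ a = 0
    · simp [ha]
    by_cases hb : p₂ b = 0
    · simp [hb]
    have ha' : q₁ a ≠ 0 := fun h => ha (ac₁ a h)
    have hb' : q₂ b ≠ 0 := fun h => hb (ac₂ b h)
    rw [mul_div_mul_comm, Real.log_mul (div_ne_zero ha ha') (div_ne_zero hb hb')]
    ring
  rw [← e.sum_comp, Fintype.sum_prod_type]
  simp_rw [hterm, Finset.sum_add_distrib, ← Finset.mul_sum, ← Finset.sum_mul, h₁, h₂, mul_one,
    one_mul]

/-- A causal product of conditional distributions has total mass one. -/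
theorem sum_prod_causal {α : Type} [Fintype α] [Nonempty α] {n : ℕ}
    (f : Fin n → (Fin n → α) → α → ℝ) (hsum : ∀ k v, ∑ a, f k v a = 1)
    (hf : ∀ k v v', (∀ i, i < k → v i = v' i) → f k v = f k v') :
    ∑ v : Fin n → α, ∏ k, f k v (v k) = 1 := by
  induction n with
  | zero => simp
  | succ n ih =>
    obtain ⟨a₀⟩ := ‹Nonempty α›
    have hcast : ∀ (k : Fin n) (v : Fin n → α) (a : α),
        f k.castSucc (Fin.snoc v a : Fin (n + 1) → α) =
          f k.castSucc (Fin.snoc v a₀ : Fin (n + 1) → α) := by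
      refine fun k v a => hf _ _ _ fun i hi => ?_
      obtain ⟨j, rfl⟩ := Fin.exists_castSucc_eq.mpr (ne_of_lt (hi.trans (Fin.castSucc_lt_last k)))
      simp
    have hlast : ∀ (v : Fin n → α) (a : α),
        f (Fin.last n) (Fin.snoc v a : Fin (n + 1) → α) =
          f (Fin.last n) (Fin.snoc v a₀ : Fin (n + 1) → α) := by
      refine fun v a => hf _ _ _ fun i hi => ?_
      obtain ⟨j, rfl⟩ := Fin.exists_castSucc_eq.mpr (ne_of_lt hi)
      simp
    rw [← (Fin.snocEquiv fun _ => α).sum_comp, Fintype.sum_prod_type_right]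
    change ∑ v : Fin n → α, ∑ a, ∏ k, f k (Fin.snoc v a : Fin (n + 1) → α)
      ((Fin.snoc v a : Fin (n + 1) → α) k) = 1
    simp only [Fin.prod_univ_castSucc, Fin.snoc_castSucc, Fin.snoc_last,
      hcast, hlast, ← Finset.mul_sum, hsum, mul_one]
    refine ih (fun k v => f k.castSucc (Fin.snoc v a₀ : Fin (n + 1) → α)) (fun k v => hsum _ _)
      fun k v v' h => hf _ _ _ fun i hi => ?_
    obtain ⟨j, rfl⟩ := Fin.exists_castSucc_eq.mpr (ne_of_lt (hi.trans (Fin.castSucc_lt_last k)))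
    simpa using h j (by simpa using hi)

theorem sum_prod_iid {α : Type} [Fintype α] {p : α → ℝ} (hp : ∑ a, p a = 1) (n : ℕ) :
    ∑ v : Fin n → α, ∏ k, p (v k) = 1 := by
  have : Nonempty α := by
    by_contra h
    have := not_nonempty_iff.mp h
    simp at hp
  exact sum_prod_causal (fun _ _ => p) (fun _ _ => hp) fun _ _ _ _ => rfl

theorem sum_marg {α β : Type} [Fintype α] [Fintype β] (f : α → β) (p : α → ℝ) :
    ∑ b, marg f p b = ∑ a, p a := by
  simp only [marg]
  rw [Finset.sum_comm]
  simp

namespace SeqCode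

variable {W X Y B : Type} [Fintype W] [Fintype X] [Fintype Y] [Fintype B] {m n : ℕ}

theorem sum_channel [Nonempty Y] [Nonempty B] (C : SeqCode W X Y B n) {PW : W → ℝ}
    (hPW : IsDist PW) (x : Fin n → X) : ∑ y, C.channel PW x y = 1 := by
  simp only [channel]
  rw [Finset.sum_comm]
  simp_rw [Finset.sum_comm (s := (Finset.univ : Finset (Fin n → Y))), ← Finset.mul_sum]
  have hdec : ∀ w b, ∑ y : Fin n → Y, ∏ k, C.dec k w b y (y k) = 1 := fun w b =>
    sum_prod_causal (fun k y => C.dec k w b y) (fun k y => (C.dec_dist k w b y).2)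
      fun k y y' h => C.dec_causal k w w b b y y' (fun _ _ => rfl) (fun _ _ => rfl) h
  have henc : ∀ w, ∑ b : Fin n → B, ∏ k, C.enc k w x b (b k) = 1 := fun w =>
    sum_prod_causal (fun k b => C.enc k w x b) (fun k b => (C.enc_dist k w x b).2)
      fun k b b' h => C.enc_causal k w w x x b b' (fun _ _ => rfl) (fun _ _ => rfl) h
  simp_rw [hdec, mul_one, ← Finset.mul_sum, henc, mul_one]
  exact sum_prod_iid hPW.2 n

theorem sum_joint [Nonempty Y] [Nonempty B] (C : SeqCode W X Y B n) {PW : W → ℝ}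
    (hPW : IsDist PW) {π : X × Y → ℝ} (hπ : IsDist π) :
    ∑ p : (Fin n → X) × (Fin n → Y),
      (∏ i, marg Prod.fst π (p.1 i)) * C.channel PW p.1 p.2 = 1 := by
  rw [Fintype.sum_prod_type]
  simp_rw [← Finset.mul_sum, C.sum_channel hPW, mul_one]
  exact sum_prod_iid ((sum_marg _ _).trans hπ.2) n

theorem channel_of_isEmpty [IsEmpty B] (hn : 1 ≤ n) (C : SeqCode W X Y B n) (PW : W → ℝ)
    (x : Fin n → X) (y : Fin n → Y) : C.channel PW x y = 0 := by
  have : Nonempty (Fin n) := ⟨⟨0, hn⟩⟩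
  simp [channel]

/-- Run `C₁` on the first `m` epochs and then `C₂`, restarted, on the last `n` epochs. -/
def append (C₁ : SeqCode W X Y B m) (C₂ : SeqCode W X Y B n) : SeqCode W X Y B (m + n) where
  enc k w x b := Fin.addCases (motive := fun _ => B → ℝ)
    (fun i => C₁.enc i (fun j => w (j.castAdd n)) (fun j => x (j.castAdd n))
      (fun j => b (j.castAdd n)))
    (fun i => C₂.enc i (fun j => w (j.natAdd m)) (fun j => x (j.natAdd m))
      (fun j => b (j.natAdd m))) k
  dec k w b y := Fin.addCases (motive := fun _ => Y → ℝ)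
    (fun i => C₁.dec i (fun j => w (j.castAdd n)) (fun j => b (j.castAdd n))
      (fun j => y (j.castAdd n)))
    (fun i => C₂.dec i (fun j => w (j.natAdd m)) (fun j => b (j.natAdd m))
      (fun j => y (j.natAdd m))) k
  enc_dist k w x b := by
    refine Fin.addCases (fun i => ?_) (fun i => ?_) k
    · simpa using C₁.enc_dist i _ _ _
    · simpa using C₂.enc_dist i _ _ _
  dec_dist k w b y := by
    refine Fin.addCases (fun i => ?_) (fun i => ?_) k
    · simpa using C₁.dec_dist i _ _ _
    · simpa using C₂.dec_dist i _ _ _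
  enc_causal k w w' x x' b b' := by
    refine Fin.addCases (fun i hw hx hb => ?_) (fun i hw hx hb => ?_) k
    · simp only [Fin.addCases_left]
      exact C₁.enc_causal i _ _ _ _ _ _ (fun j hj => hw _ hj)
        (fun j hj => hx _ hj) fun j hj => hb _ hj
    · simp only [Fin.addCases_right]
      exact C₂.enc_causal i _ _ _ _ _ _ (fun j hj => hw _ (by simpa using hj))
        (fun j hj => hx _ (by simpa using hj)) fun j hj => hb _ (by simpa using hj)
  dec_causal k w w' b b' y y' := by
    refine Fin.addCases (fun i hw hb hy => ?_) (fun i hw hb hy => ?_) k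
    · simp only [Fin.addCases_left]
      exact C₁.dec_causal i _ _ _ _ _ _ (fun j hj => hw _ hj)
        (fun j hj => hb _ hj) fun j hj => hy _ hj
    · simp only [Fin.addCases_right]
      exact C₂.dec_causal i _ _ _ _ _ _ (fun j hj => hw _ (by simpa using hj))
        (fun j hj => hb _ (by simpa using hj)) fun j hj => hy _ (by simpa using hj)

theorem channel_append (C₁ : SeqCode W X Y B m) (C₂ : SeqCode W X Y B n) (PW : W → ℝ)
    (x₁ : Fin m → X) (x₂ : Fin n → X) (y₁ : Fin m → Y) (y₂ : Fin n → Y) :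
    (C₁.append C₂).channel PW (Fin.append x₁ x₂) (Fin.append y₁ y₂) =
      C₁.channel PW x₁ y₁ * C₂.channel PW x₂ y₂ := by
  simp only [channel]
  rw [← (Fin.appendEquiv m n).sum_comp, Fintype.sum_prod_type, Finset.sum_mul_sum]
  refine Finset.sum_congr rfl fun w₁ _ => Finset.sum_congr rfl fun w₂ _ => ?_
  rw [← (Fin.appendEquiv m n).sum_comp, Fintype.sum_prod_type, Finset.sum_mul_sum]
  refine Finset.sum_congr rfl fun b₁ _ => Finset.sum_congr rfl fun b₂ _ => ?_
  simp only [Fin.appendEquiv, Equiv.coe_fn_mk, append, Fin.prod_univ_add, Fin.append_left,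
    Fin.append_right, Fin.addCases_left, Fin.addCases_right]
  ring

end SeqCode

/-- `Γ^{(n)}(π_{XY}, P_W)` is subadditive in the blocklength. -/
theorem GammaN_subadditive
    (W X Y B : Type) [Fintype W] [Fintype X] [Fintype Y] [Fintype B]
    (PW : W → ℝ) (hPW : IsDist PW)
    (π : X × Y → ℝ) (hπ : IsDist π)
    (m n : ℕ) (hm : 1 ≤ m) (hn : 1 ≤ n) :
    GammaN W X Y B PW π (m + n) ≤ GammaN W X Y B PW π m + GammaN W X Y B PW π n := by
  have : Nonempty Y := by
    by_contra h
    have := not_nonempty_iff.mp h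
    simpa using hπ.2
  simp only [GammaN, sInf_eq_iInf']
  refine ENNReal.le_iInf_add_iInf ?_
  rintro ⟨_, C₁, rfl⟩ ⟨_, C₂, rfl⟩
  refine iInf_le_of_le ⟨_, C₁.append C₂, rfl⟩ ?_
  rcases isEmpty_or_nonempty B with hB | hB
  · simp [KL, SeqCode.channel_of_isEmpty (show 1 ≤ m + n by omega)]
  refine KL_le_add_of_tensor ((Equiv.prodProdProdComm _ _ _ _).trans
    ((Fin.appendEquiv m n).prodCongr (Fin.appendEquiv m n))) ?_ ?_
    (C₁.sum_joint hPW hπ) (C₂.sum_joint hPW hπ)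
  · rintro ⟨x₁, y₁⟩ ⟨x₂, y₂⟩
    simp only [Equiv.trans_apply, Equiv.prodProdProdComm_apply, Equiv.prodCongr_apply,
      Prod.map_apply, Fin.appendEquiv, Equiv.coe_fn_mk, SeqCode.channel_append,
      Fin.prod_univ_add, Fin.append_left, Fin.append_right]
    ring
  · rintro ⟨x₁, y₁⟩ ⟨x₂, y₂⟩
    simp [Fin.appendEquiv, Fin.prod_univ_add]

end
end

section
/- Let 𝒳, 𝒴, 𝓑 be finite sets and π_{XY} a distribution on 𝒳×𝒴. For any n ≥ 1 and any restricted sequential code {(P_{B_k|X^k}, P_{Y_k|B^k Y^{k-1}})}_{k=1}^n, the induced channel P_{Y^n|X^n} satisfies D(P_{Y^n|X^n} ‖ π_{Y|X}^n | π_X^n) ≥ Σ_{k=1}^n min_{x^{k-1} ∈ 𝒳^{k-1}} D(P_{Y_k|X_k, X^{k-1}=x^{k-1}} ‖ π_{Y|X} | π_X), where P_{Y_k|X_k, X^{k-1}=x^{k-1}} is the conditional distribution of Y_k given X_k under the joint distribution of (X^k, B^k, Y^k) induced by the code with X^k ∼ π_X^k, conditioned on X^{k-1} = x^{k-1}. 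-/
open scoped BigOperators ENNReal
open Classical

noncomputable section

/-- A restricted sequential code of blocklength `n`: at epoch `k` the encoder
generates `B_k` from `X^k` only, and the decoder generates `Y_k` from
`(B^k, Y^{k-1})`; there is no common randomness. -/
structure RSeqCode (X Y B : Type) [Fintype X] [Fintype Y] [Fintype B] (n : ℕ) where
  enc : Fin n → (Fin n → X) → B → ℝ
  dec : Fin n → (Fin n → B) → (Fin n → Y) → Y → ℝ
  enc_dist : ∀ k x, IsDist (enc k x)
  dec_dist : ∀ k b y, IsDist (dec k b y)
  enc_causal : ∀ k x x', (∀ i, i ≤ k → x i = x' i) → enc k x = enc k x'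
  dec_causal : ∀ k b b' y y',
    (∀ i, i ≤ k → b i = b' i) → (∀ i, i < k → y i = y' i) → dec k b y = dec k b' y'

/-- The channel `P_{Y^n|X^n}` synthesized by a restricted sequential code. -/
def RSeqCode.channel {X Y B : Type} [Fintype X] [Fintype Y] [Fintype B] {n : ℕ}
    (C : RSeqCode X Y B n) (x : Fin n → X) (y : Fin n → Y) : ℝ :=
  ∑ b : Fin n → B, (∏ k, C.enc k x (b k)) * (∏ k, C.dec k b y (y k))

/-- The conditional distribution `P_{Y_k | X^k = x^k}` induced by a restricted
sequential code (it depends on `xs` only through the coordinates `≤ k`). -/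
def RSeqCode.condY {X Y B : Type} [Fintype X] [Fintype Y] [Fintype B] {n : ℕ}
    (C : RSeqCode X Y B n) (k : Fin n) (xs : Fin n → X) (y : Y) : ℝ :=
  ∑ b : Fin n → B, ∑ yv : Fin n → Y,
    (if yv k = y then (1 : ℝ) else 0) *
      (∏ j, C.enc j xs (b j)) * (∏ j, C.dec j b yv (yv j))

/-- Gibbs' inequality for nonnegative functions on a finite type. -/
lemma gibbs_nonneg {α : Type} [Fintype α] {p q : α → ℝ} (hp : ∀ a, 0 ≤ p a)
    (hq : ∀ a, 0 ≤ q a) (hac : ∀ a, q a = 0 → p a = 0) (h : ∑ a, q a ≤ ∑ a, p a) :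
    0 ≤ ∑ a, p a * Real.log (p a / q a) := by
  have key : ∀ a, p a - q a ≤ p a * Real.log (p a / q a) := by
    intro a
    rcases (hp a).eq_or_lt with h0 | h0
    · rw [← h0]
      simpa using hq a
    · have hqa : 0 < q a := lt_of_le_of_ne (hq a) fun h => h0.ne' (hac a h.symm)
      have h1 := Real.one_sub_inv_le_log_of_pos (div_pos h0 hqa)
      have h2 := mul_le_mul_of_nonneg_left h1 h0.le
      have h3 : p a * (1 - (p a / q a)⁻¹) = p a - q a := by field_simp
      linarith
  have hsum := Finset.sum_le_sum fun a (_ : a ∈ Finset.univ) => key a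
  rw [Finset.sum_sub_distrib] at hsum
  linarith

/-- A product of causal conditional distributions is a distribution on sequences. -/
lemma sum_prod_causal_eq_one {Y : Type} [Fintype Y] [Nonempty Y] {n : ℕ}
    (f : Fin n → (Fin n → Y) → Y → ℝ) (hf : ∀ k y, ∑ z, f k y z = 1)
    (hc : ∀ k y y', (∀ i, i < k → y i = y' i) → f k y = f k y') :
    ∑ y : Fin n → Y, ∏ k, f k y (y k) = 1 := by
  induction n with
  | zero => simp
  | succ n ih =>
    rw [← (Fin.consEquiv fun _ : Fin (n + 1) => Y).sum_comp, Fintype.sum_prod_type]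
    obtain ⟨y₀⟩ := ‹Nonempty Y›
    calc _ = ∑ z, f 0 (fun _ => y₀) z := by
          refine Finset.sum_congr rfl fun z _ => ?_
          have h := ih (fun k y => f k.succ (Fin.cons z y)) (fun k y => hf _ _) (by
            intro k y y' h
            refine hc _ _ _ fun i => ?_
            refine Fin.cases (fun _ => rfl) (fun j hj => ?_) i
            simpa using h j (Fin.succ_lt_succ_iff.mp hj))
          simp only [Fin.consEquiv_apply, Fin.prod_univ_succ, Fin.cons_zero, Fin.cons_succ]
          have hcons : ∀ y : Fin n → Y, Fin.consEquiv (fun _ => Y) (z, y) =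
              (Fin.cons z y : Fin (n + 1) → Y) := fun _ => rfl
          have h0 : ∀ y : Fin n → Y,
              f 0 (Fin.cons z y : Fin (n + 1) → Y) = f 0 (fun _ => y₀) :=
            fun y => hc _ _ _ fun i hi => absurd hi (Fin.not_lt_zero i)
          simp only [hcons, h0, ← Finset.mul_sum]
          rw [h, mul_one]
      _ = 1 := hf _ _

/-- Resampling one coordinate of an i.i.d. sequence leaves expectations unchanged. -/
lemma sum_iid_update {X : Type} [Fintype X] {n : ℕ} {m : X → ℝ} (hm : ∑ a, m a = 1)
    (k : Fin n) (F : (Fin n → X) → ℝ) :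
    ∑ x, (∏ i, m (x i)) * ∑ a, m a * F (Function.update x k a) =
      ∑ x, (∏ i, m (x i)) * F x := by
  let swap : (Fin n → X) × X → (Fin n → X) × X := fun p => (Function.update p.1 k p.2, p.1 k)
  have hswap : Function.Involutive swap := by
    rintro ⟨x, a⟩
    simp [swap]
  have hw : ∀ (x : Fin n → X) a,
      (∏ i, m (Function.update x k a i)) * m (x k) = (∏ i, m (x i)) * m a := by
    intro x a
    rw [← Finset.mul_prod_erase _ _ (Finset.mem_univ k),
      ← Finset.mul_prod_erase _ (fun i => m (x i)) (Finset.mem_univ k), Function.update_self,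
      Finset.prod_congr rfl fun i hi => by
        rw [Function.update_of_ne (Finset.ne_of_mem_erase hi)]]
    ring
  calc _ = ∑ p : (Fin n → X) × X,
        (∏ i, m (p.1 i)) * m p.2 * F (Function.update p.1 k p.2) := by
        rw [Fintype.sum_prod_type]
        simp only [Finset.mul_sum, mul_assoc]
    _ = ∑ p : (Fin n → X) × X, (∏ i, m (p.1 i)) * m p.2 * F p.1 := by
        refine Fintype.sum_equiv hswap.toPerm _ _ fun p => ?_
        simp only [Function.Involutive.coe_toPerm, swap, hw]
    _ = _ := by
        rw [Fintype.sum_prod_type]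
        refine Finset.sum_congr rfl fun x _ => ?_
        simp only [← Finset.sum_mul, ← Finset.mul_sum, hm, mul_one]

lemma marg_fst_apply {X Y : Type} [Fintype X] [Fintype Y] (π : X × Y → ℝ) (a : X) :
    marg Prod.fst π a = ∑ y, π (a, y) := by
  simp only [marg, Fintype.sum_prod_type]
  rw [Finset.sum_eq_single a (fun b _ hb => by simp [hb]) (by simp)]
  simp

lemma isDist_marg_fst {X Y : Type} [Fintype X] [Fintype Y] {π : X × Y → ℝ} (hπ : IsDist π) :
    IsDist (marg Prod.fst π) := by
  refine ⟨fun a => ?_, ?_⟩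
  · rw [marg_fst_apply]
    exact Finset.sum_nonneg fun y _ => hπ.1 _
  · simp only [marg_fst_apply]
    rw [← Fintype.sum_prod_type, hπ.2]

lemma isDist_iid {X : Type} [Fintype X] {m : X → ℝ} (hm : IsDist m) (n : ℕ) :
    IsDist fun x : Fin n → X => ∏ i, m (x i) := by
  refine ⟨fun x => Finset.prod_nonneg fun i _ => hm.1 _, ?_⟩
  rw [← Fintype.prod_sum]
  simp [hm.2]

namespace RSeqCode

variable {X Y B : Type} [Fintype X] [Fintype Y] [Fintype B] {n : ℕ} (C : RSeqCode X Y B n)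

lemma isDist_channel [Nonempty Y] (x : Fin n → X) : IsDist (C.channel x) := by
  refine ⟨fun y => Finset.sum_nonneg fun b _ => mul_nonneg
    (Finset.prod_nonneg fun k _ => (C.enc_dist k x).1 _)
    (Finset.prod_nonneg fun k _ => (C.dec_dist k b y).1 _), ?_⟩
  have h : ∀ b, ∑ y : Fin n → Y, ∏ k, C.dec k b y (y k) = 1 := fun b =>
    sum_prod_causal_eq_one (fun k => C.dec k b) (fun k y => (C.dec_dist k b y).2)
      fun k y y' h => C.dec_causal k b b y y' (fun _ _ => rfl) h
  simp only [channel]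
  rw [Finset.sum_comm]
  simp only [← Finset.mul_sum, h, mul_one]
  rw [← Fintype.prod_sum]
  simp [(C.enc_dist _ x).2]

lemma condY_eq_sum_channel (k : Fin n) (x : Fin n → X) (z : Y) :
    C.condY k x z = ∑ y : Fin n → Y, if y k = z then C.channel x y else 0 := by
  simp only [condY, channel]
  rw [Finset.sum_comm]
  refine Finset.sum_congr rfl fun y _ => ?_
  split_ifs <;> simp

lemma sum_condY_mul (k : Fin n) (x : Fin n → X) (G : Y → ℝ) :
    ∑ z, C.condY k x z * G z = ∑ y : Fin n → Y, C.channel x y * G (y k) := by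
  simp only [condY_eq_sum_channel, Finset.sum_mul, ite_mul, zero_mul]
  rw [Finset.sum_comm]
  simp

lemma isDist_condY [Nonempty Y] (k : Fin n) (x : Fin n → X) : IsDist (C.condY k x) := by
  have hC := C.isDist_channel x
  constructor
  · intro z
    rw [condY_eq_sum_channel]
    exact Finset.sum_nonneg fun y _ => by split_ifs <;> simp [hC.1 y]
  · simpa [hC.2] using C.sum_condY_mul k x 1

lemma channel_le_condY [Nonempty Y] (k : Fin n) (x : Fin n → X) (y : Fin n → Y) :
    C.channel x y ≤ C.condY k x (y k) := by
  have hC := C.isDist_channel x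
  rw [condY_eq_sum_channel]
  calc C.channel x y = if y k = y k then C.channel x y else 0 := by simp
    _ ≤ _ := Finset.single_le_sum
      (f := fun y' : Fin n → Y => if y' k = y k then C.channel x y' else 0)
      (fun y' _ => by split_ifs <;> simp [hC.1 y']) (Finset.mem_univ y)

/-- The expectation of a sum of per-letter scores only involves the per-letter conditionals. -/
lemma sum_iid_channel_mul_sum {m : X → ℝ} (hm : ∑ a, m a = 1)
    (G : Fin n → (Fin n → X) → Y → ℝ) :
    ∑ p : (Fin n → X) × (Fin n → Y),
        (∏ i, m (p.1 i)) * C.channel p.1 p.2 * ∑ k, G k p.1 (p.2 k) =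
      ∑ k, ∑ x, (∏ i, m (x i)) * ∑ q : X × Y,
        m q.1 * C.condY k (Function.update x k q.1) q.2 * G k (Function.update x k q.1) q.2 := by
  calc _ = ∑ k, ∑ x, (∏ i, m (x i)) * ∑ z, C.condY k x z * G k x z := by
        simp only [sum_condY_mul, Finset.mul_sum, ← mul_assoc]
        rw [Finset.sum_comm]
        simp only [Fintype.sum_prod_type]
    _ = _ := by
        refine Finset.sum_congr rfl fun k _ => ?_
        rw [← sum_iid_update hm k]
        simp only [Fintype.sum_prod_type, Finset.mul_sum, mul_assoc]

/-- The divergence of the synthesized channel dominates the sum of the averaged per-letter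
divergences. -/
lemma sum_avg_div_le [Nonempty Y] {m : X → ℝ} (hm : IsDist m) {π : X × Y → ℝ}
    (hac : ∀ p : (Fin n → X) × (Fin n → Y),
      ∏ i, π (p.1 i, p.2 i) = 0 → (∏ i, m (p.1 i)) * C.channel p.1 p.2 = 0) :
    ∑ k, ∑ x, (∏ i, m (x i)) * ∑ q : X × Y,
        m q.1 * C.condY k (Function.update x k q.1) q.2 *
          Real.log (m q.1 * C.condY k (Function.update x k q.1) q.2 / π q) ≤
      ∑ p : (Fin n → X) × (Fin n → Y), (∏ i, m (p.1 i)) * C.channel p.1 p.2 *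
        Real.log ((∏ i, m (p.1 i)) * C.channel p.1 p.2 / ∏ i, π (p.1 i, p.2 i)) := by
  have hw := isDist_iid hm n
  have hP : ∀ p : (Fin n → X) × (Fin n → Y), 0 ≤ (∏ i, m (p.1 i)) * C.channel p.1 p.2 :=
    fun p => mul_nonneg (hw.1 p.1) ((C.isDist_channel p.1).1 p.2)
  have hpos : ∀ p : (Fin n → X) × (Fin n → Y), 0 < (∏ i, m (p.1 i)) * C.channel p.1 p.2 →
      ∀ k, 0 < m (p.1 k) * C.condY k p.1 (p.2 k) := by
    intro p hp k
    have h1 : (∏ i, m (p.1 i)) ≠ 0 := left_ne_zero_of_mul hp.ne'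
    have h2 : 0 < C.channel p.1 p.2 :=
      lt_of_le_of_ne ((C.isDist_channel p.1).1 p.2) (right_ne_zero_of_mul hp.ne').symm
    exact mul_pos
      (lt_of_le_of_ne (hm.1 _) (Finset.prod_ne_zero_iff.mp h1 k (Finset.mem_univ k)).symm)
      (h2.trans_le (C.channel_le_condY k p.1 p.2))
  have hR : ∀ p : (Fin n → X) × (Fin n → Y), 0 ≤ ∏ k, m (p.1 k) * C.condY k p.1 (p.2 k) :=
    fun p => Finset.prod_nonneg fun k _ => mul_nonneg (hm.1 _) ((C.isDist_condY k p.1).1 _)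
  have hgibbs := gibbs_nonneg hP hR (fun p h0 => by
      by_contra hne
      exact (Finset.prod_pos fun k _ => hpos p ((hP p).lt_of_ne (Ne.symm hne)) k).ne' h0) (by
      simp only [Fintype.sum_prod_type, ← Finset.mul_sum, (C.isDist_channel _).2,
        Finset.prod_mul_distrib]
      refine le_of_eq (Finset.sum_congr rfl fun x _ => ?_)
      rw [← Fintype.prod_sum]
      simp [(C.isDist_condY _ x).2])
  have hsplit := C.sum_iid_channel_mul_sum hm.2 fun k x z =>
    Real.log (m (x k) * C.condY k x z / π (x k, z))
  simp only [Function.update_self, Prod.mk.eta] at hsplit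
  rw [← hsplit, ← sub_nonneg, ← Finset.sum_sub_distrib]
  refine hgibbs.trans_eq (Finset.sum_congr rfl fun p _ => ?_)
  rcases (hP p).eq_or_lt with h0 | h0
  · rw [← h0]
    simp
  · have hQ : ∏ i, π (p.1 i, p.2 i) ≠ 0 := fun h => h0.ne' (hac p h)
    have hr := hpos p h0
    have hR' := (Finset.prod_pos fun k (_ : k ∈ Finset.univ) => hr k).ne'
    rw [← mul_sub, ← Real.log_prod fun k _ =>
      div_ne_zero (hr k).ne' (Finset.prod_ne_zero_iff.mp hQ k (Finset.mem_univ k)),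
      Finset.prod_div_distrib, Real.log_div h0.ne' hR', Real.log_div h0.ne' hQ,
      Real.log_div hR' hQ]
    ring

/-- Absolute continuity of the block divergence passes to each per-letter conditional whose past
has positive probability. -/
lemma condY_absolutelyContinuous {m : X → ℝ} {π : X × Y → ℝ}
    (hac : ∀ p : (Fin n → X) × (Fin n → Y),
      ∏ i, π (p.1 i, p.2 i) = 0 → (∏ i, m (p.1 i)) * C.channel p.1 p.2 = 0)
    (k : Fin n) {x : Fin n → X} (hx : ∏ i, m (x i) ≠ 0) (q : X × Y) (hq : π q = 0) :
    m q.1 * C.condY k (Function.update x k q.1) q.2 = 0 := by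
  by_cases hm : m q.1 = 0
  · rw [hm, zero_mul]
  rw [condY_eq_sum_channel, Finset.sum_eq_zero, mul_zero]
  intro y _
  split_ifs with hy
  · refine (mul_eq_zero.mp (hac (Function.update x k q.1, y) ?_)).resolve_left ?_
    · exact Finset.prod_eq_zero (Finset.mem_univ k) (by simp [hy, hq])
    · refine Finset.prod_ne_zero_iff.mpr fun i _ => ?_
      by_cases hi : i = k
      · subst hi
        simpa using hm
      · simpa [hi] using Finset.prod_ne_zero_iff.mp hx i (Finset.mem_univ i)
  · rfl

end RSeqCode


/-- for any restricted sequential code,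
`D(P_{Y^n|X^n} ‖ π_{Y|X}^n | π_X^n) ≥ Σ_k min_{x^{k-1}} D(P_{Y_k|X_k, X^{k-1}=x^{k-1}} ‖ π_{Y|X} | π_X)`. -/
theorem restricted_sequential_converse_bound
    (X Y B : Type) [Fintype X] [Fintype Y] [Fintype B]
    (π : X × Y → ℝ) (hπ : IsDist π)
    (n : ℕ) (C : RSeqCode X Y B n) :
    ∑ k : Fin n, ⨅ xp : Fin n → X,
        KL (fun p : X × Y =>
              marg Prod.fst π p.1 * C.condY k (Function.update xp k p.1) p.2) π ≤
      KL
        (fun p : (Fin n → X) × (Fin n → Y) =>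
          (∏ i, marg Prod.fst π (p.1 i)) * C.channel p.1 p.2)
        (fun p : (Fin n → X) × (Fin n → Y) => ∏ i, π (p.1 i, p.2 i)) := by
  obtain ⟨hX, hY⟩ : Nonempty X ∧ Nonempty Y := by
    have : Nonempty (X × Y) := by
      by_contra h
      rw [not_nonempty_iff] at h
      simpa using hπ.2
    exact nonempty_prod.mp this
  have hm := isDist_marg_fst hπ
  have hw := isDist_iid hm n
  set m := marg Prod.fst π
  by_cases hac : ∀ p : (Fin n → X) × (Fin n → Y),
      ∏ i, π (p.1 i, p.2 i) = 0 → (∏ i, m (p.1 i)) * C.channel p.1 p.2 = 0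
  swap
  · exact le_top.trans_eq (if_neg hac).symm
  set I : Fin n → ℝ≥0∞ := fun k => ⨅ x : Fin n → X,
    KL (fun q : X × Y => m q.1 * C.condY k (Function.update x k q.1) q.2) π
  set d : Fin n → (Fin n → X) → ℝ := fun k x => ∑ q : X × Y,
    m q.1 * C.condY k (Function.update x k q.1) q.2 *
      Real.log (m q.1 * C.condY k (Function.update x k q.1) q.2 / π q)
  have hId : ∀ k x, ∏ i, m (x i) ≠ 0 → I k ≤ ENNReal.ofReal (d k x) := fun k x hx =>
    (iInf_le _ x).trans_eq (if_pos (C.condY_absolutelyContinuous hac k hx))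
  obtain ⟨x₀, hx₀⟩ : ∃ x : Fin n → X, ∏ i, m (x i) ≠ 0 := by
    by_contra! h
    simpa [h] using hw.2
  have hItop : ∀ k, I k ≠ ⊤ := fun k => ne_top_of_le_ne_top ENNReal.ofReal_ne_top (hId k x₀ hx₀)
  have hd0 : ∀ k x, ∏ i, m (x i) ≠ 0 → 0 ≤ d k x := fun k x hx =>
    gibbs_nonneg (fun q => mul_nonneg (hm.1 _) ((C.isDist_condY _ _).1 _)) hπ.1
      (C.condY_absolutelyContinuous hac k hx) (by
        simp only [hπ.2, Fintype.sum_prod_type, ← Finset.mul_sum, (C.isDist_condY _ _).2,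
          mul_one, hm.2, le_refl])
  have hreal : ∀ k, (I k).toReal ≤ ∑ x, (∏ i, m (x i)) * d k x := by
    intro k
    rw [← one_mul (I k).toReal, ← hw.2, Finset.sum_mul]
    refine Finset.sum_le_sum fun x _ => ?_
    by_cases hx : ∏ i, m (x i) = 0
    · simp [hx]
    · exact mul_le_mul_of_nonneg_left
        (ENNReal.toReal_le_of_le_ofReal (hd0 k x hx) (hId k x hx)) (hw.1 x)
  calc ∑ k, I k = ENNReal.ofReal (∑ k, (I k).toReal) := by
        rw [ENNReal.ofReal_sum_of_nonneg fun k _ => ENNReal.toReal_nonneg]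
        exact Finset.sum_congr rfl fun k _ => (ENNReal.ofReal_toReal (hItop k)).symm
    _ ≤ ENNReal.ofReal _ := ENNReal.ofReal_le_ofReal
        ((Finset.sum_le_sum fun k _ => hreal k).trans (C.sum_avg_div_le hm hac))
    _ = _ := (if_pos hac).symm

end
end
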